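/- arXiv:2512.14581 — 3 statements merged into one kernel-verified Lean document; each statement's English description precedes it below -/
import Mathlib

section
/- Let p ∈ ℝ_{≥0}, let f ∈ C^∞(ℝ) be such that f' is of precise order −p−1, let n ≥ 2, and define g_n : ℝ → ℝ by g_n(x) := −x^{n−2} f'(1/x) for x ≠ 0 and g_n(0) := 0. Then there exist δ, c_1, c_2 > 0 such that c_1 |x|^p ≤ |g_n^{(n−1)}(x)| ≤ c_2 |x|^p for all x with 0 < |x| < δ. -/
/-- `f` is of precise order `r`: for every `k` there are `R, c₁, c₂ > 0` with
`c₁ |x|^(r-k) ≤ |f^(k)(x)| ≤ c₂ |x|^(r-k)` for all `|x| > R`. -/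
def PreciseOrder (f : ℝ → ℝ) (r : ℝ) : Prop :=
  ∀ k : ℕ, ∃ R c₁ c₂ : ℝ, 0 < R ∧ 0 < c₁ ∧ 0 < c₂ ∧
    ∀ x : ℝ, R < |x| →
      c₁ * |x| ^ (r - (k : ℝ)) ≤ |iteratedDeriv k f x| ∧
        |iteratedDeriv k f x| ≤ c₂ * |x| ^ (r - (k : ℝ))

/-- The function `g_n(x) = −x^(n−2) f'(1/x)` for `x ≠ 0`, with `g_n(0) = 0`. -/
noncomputable def gfun (f : ℝ → ℝ) (n : ℕ) (x : ℝ) : ℝ :=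
  if x = 0 then 0 else -x ^ (n - 2) * deriv f (1 / x)

/-- The Leibniz rule for the product with the identity function. -/
lemma iteratedDeriv_succ_id_mul {u : ℝ → ℝ} {x : ℝ} (m : ℕ)
    (hu : ContDiffAt ℝ (m + 1 : ℕ) u x) :
    iteratedDeriv (m + 1) (fun y => y * u y) x =
      x * iteratedDeriv (m + 1) u x + (m + 1) * iteratedDeriv m u x := by
  rw [iteratedDeriv_fun_mul contDiffAt_fun_id hu, Finset.sum_range_succ', Finset.sum_range_succ']
  rw [Finset.sum_eq_zero]
  · simp [iteratedDeriv_fun_id]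
    ring
  · intro i _
    simp [iteratedDeriv_fun_id]

/-- The derivative identity `(d/dx)^m [x^(m-1) h(1/x)] = (-1)^m x^(-m-1) h^(m)(1/x)`. -/
lemma iteratedDeriv_pow_mul_inv_mul_comp_inv {h : ℝ → ℝ} (hh : ContDiff ℝ (⊤ : ℕ∞) h) (m : ℕ)
    {x : ℝ} (hx : x ≠ 0) :
    iteratedDeriv m (fun y => y ^ m * (y⁻¹ * h y⁻¹)) x =
      (-1) ^ m * ((x⁻¹) ^ (m + 1) * iteratedDeriv m h x⁻¹) := by
  induction m generalizing x with
  | zero => simp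
  | succ m ih =>
    have hu : ContDiffAt ℝ (m + 1 : ℕ) (fun y => y ^ m * (y⁻¹ * h y⁻¹)) x := by
      have hinv : ContDiffAt ℝ (m + 1 : ℕ) (fun y : ℝ => y⁻¹) x := contDiffAt_inv ℝ hx
      have hh' : ContDiffAt ℝ (m + 1 : ℕ) h x⁻¹ :=
        hh.contDiffAt.of_le (by exact_mod_cast le_top)
      exact (contDiffAt_id.pow m).mul (hinv.mul (hh'.comp x hinv))
    have hderiv : HasDerivAt (fun y => (-1) ^ m * ((y⁻¹) ^ (m + 1) * iteratedDeriv m h y⁻¹))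
        ((-1) ^ m * (((m + 1 : ℕ) * (x⁻¹) ^ m * (-(x ^ 2)⁻¹)) * iteratedDeriv m h x⁻¹ +
          (x⁻¹) ^ (m + 1) * (iteratedDeriv (m + 1) h x⁻¹ * (-(x ^ 2)⁻¹)))) x := by
      have hinv := hasDerivAt_inv hx
      have hit : HasDerivAt (iteratedDeriv m h) (iteratedDeriv (m + 1) h x⁻¹) x⁻¹ := by
        rw [iteratedDeriv_succ]
        exact ((hh.differentiable_iteratedDeriv m
          (by exact_mod_cast ENat.natCast_lt_top m)) x⁻¹).hasDerivAt
      exact ((hinv.fun_pow (m + 1)).mul (hit.comp x hinv)).const_mul _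
    have hev : iteratedDeriv m (fun y => y ^ m * (y⁻¹ * h y⁻¹)) =ᶠ[nhds x]
        fun y => (-1) ^ m * ((y⁻¹) ^ (m + 1) * iteratedDeriv m h y⁻¹) := by
      filter_upwards [isOpen_ne.mem_nhds hx] with y hy using ih hy
    have hfun : (fun y => y ^ (m + 1) * (y⁻¹ * h y⁻¹)) =
        fun y => y * (y ^ m * (y⁻¹ * h y⁻¹)) := by
      ext y; ring
    rw [hfun, iteratedDeriv_succ_id_mul m hu, ih hx, iteratedDeriv_succ, hev.deriv_eq,
      hderiv.deriv]
    push_cast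
    rw [← inv_pow]
    linear_combination (-(-1) ^ m * ((m + 1) * (x⁻¹) ^ (m + 1) * iteratedDeriv m h x⁻¹ +
      (x⁻¹) ^ (m + 2) * iteratedDeriv (m + 1) h x⁻¹)) * mul_inv_cancel₀ hx

lemma abs_iteratedDeriv_gfun {f : ℝ → ℝ} (hf : ContDiff ℝ (⊤ : ℕ∞) f) {n : ℕ} (hn : 2 ≤ n)
    {x : ℝ} (hx : x ≠ 0) :
    |iteratedDeriv (n - 1) (gfun f n) x| =
      |x⁻¹| ^ n * |iteratedDeriv (n - 1) (deriv f) x⁻¹| := by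
  obtain ⟨k, rfl⟩ := Nat.exists_eq_add_of_le' hn
  have hev : gfun f (k + 2) =ᶠ[nhds x]
      fun y => -(y ^ (k + 1) * (y⁻¹ * deriv f y⁻¹)) := by
    filter_upwards [isOpen_ne.mem_nhds hx] with y hy
    have hy' : y ≠ 0 := hy
    simp only [gfun, if_neg hy', one_div, Nat.add_sub_cancel]
    field_simp
    ring
  have hf' : ContDiff ℝ (⊤ : ℕ∞) (deriv f) := (contDiff_infty_iff_deriv.1 hf).2
  rw [hev.iteratedDeriv_eq, iteratedDeriv_fun_neg, show k + 2 - 1 = k + 1 from rfl,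
    iteratedDeriv_pow_mul_inv_mul_comp_inv hf' (k + 1) hx]
  simp [abs_mul]

/-- if `f'` is of precise order `−p−1` (`p ≥ 0`) and `n ≥ 2`, then
near `0` (away from `0` itself) one has `c₁ |x|^p ≤ |g_n^(n−1)(x)| ≤ c₂ |x|^p`. -/
theorem statement3 (p : ℝ) (hp : 0 ≤ p) (f : ℝ → ℝ) (hf : ContDiff ℝ (⊤ : ℕ∞) f)
    (hord : PreciseOrder (deriv f) (-p - 1)) (n : ℕ) (hn : 2 ≤ n) :
    ∃ δ c₁ c₂ : ℝ, 0 < δ ∧ 0 < c₁ ∧ 0 < c₂ ∧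
      ∀ x : ℝ, 0 < |x| → |x| < δ →
        c₁ * |x| ^ p ≤ |iteratedDeriv (n - 1) (gfun f n) x| ∧
          |iteratedDeriv (n - 1) (gfun f n) x| ≤ c₂ * |x| ^ p := by
  obtain ⟨R, c₁, c₂, hR, hc₁, hc₂, hbound⟩ := hord (n - 1)
  refine ⟨R⁻¹, c₁, c₂, inv_pos.2 hR, hc₁, hc₂, fun x hx hxδ => ?_⟩
  have hx0 : x ≠ 0 := abs_pos.1 hx
  obtain ⟨hlow, hupp⟩ := hbound x⁻¹ (by rw [abs_inv]; exact (lt_inv_comm₀ hx hR).1 hxδ)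
  have hpow : |x| ^ p = |x⁻¹| ^ n * |x⁻¹| ^ (-p - 1 - ((n - 1 : ℕ) : ℝ)) := by
    have hpos : 0 < |x⁻¹| := abs_pos.2 (inv_ne_zero hx0)
    rw [← Real.rpow_natCast, ← Real.rpow_add hpos, Nat.cast_sub (by omega), abs_inv,
      Real.inv_rpow hx.le, ← Real.rpow_neg hx.le]
    congr 1
    push_cast
    ring
  rw [abs_iteratedDeriv_gfun hf hn hx0, hpow, mul_left_comm c₁, mul_left_comm c₂]
  exact ⟨by gcongr, by gcongr⟩
end

section
/- Let f ∈ C^∞(ℝ) be such that f' is of order at most r for some r < −1, let n ≥ 2, and define g_n : ℝ → ℝ by g_n(x) := −x^{n−2} f'(1/x) for x ≠ 0 and g_n(0) := 0. Then g_n is of class C^{n−1} on all of ℝ. -/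
/-- `f` is of order at most `r`: for every `k` there are `R, c₂ > 0` with
`|f^(k)(x)| ≤ c₂ |x|^(r-k)` for all `|x| > R`. -/
def OrderAtMost (f : ℝ → ℝ) (r : ℝ) : Prop :=
  ∀ k : ℕ, ∃ R c₂ : ℝ, 0 < R ∧ 0 < c₂ ∧
    ∀ x : ℝ, R < |x| → |iteratedDeriv k f x| ≤ c₂ * |x| ^ (r - (k : ℝ))

theorem OrderAtMost.deriv {h : ℝ → ℝ} {r : ℝ} (hh : OrderAtMost h r) :
    OrderAtMost (deriv h) (r - 1) := by
  intro k
  obtain ⟨R, c, hR, hc, hb⟩ := hh (k + 1)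
  refine ⟨R, c, hR, hc, fun x hx => ?_⟩
  have hx' := hb x hx
  rw [iteratedDeriv_succ'] at hx'
  rwa [show r - 1 - (k : ℝ) = r - ((k + 1 : ℕ) : ℝ) by push_cast; ring]

/-- The function `x ↦ x ^ a * h (x⁻¹)`, extended by `0` at the origin. -/
noncomputable def inversionMul (a : ℤ) (h : ℝ → ℝ) (x : ℝ) : ℝ :=
  if x = 0 then 0 else x ^ a * h x⁻¹

@[simp]
theorem inversionMul_zero (a : ℤ) (h : ℝ → ℝ) : inversionMul a h 0 = 0 := if_pos rfl

theorem inversionMul_of_ne_zero (a : ℤ) (h : ℝ → ℝ) {x : ℝ} (hx : x ≠ 0) :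
    inversionMul a h x = x ^ a * h x⁻¹ := if_neg hx

theorem OrderAtMost.eventually_abs_inversionMul_le {h : ℝ → ℝ} {r : ℝ} (hh : OrderAtMost h r)
    (a : ℤ) : ∃ c : ℝ, ∀ᶠ x in nhds (0 : ℝ), |inversionMul a h x| ≤ c * |x| ^ ((a : ℝ) - r) := by
  obtain ⟨R, c, hR, hc, hb⟩ := hh 0
  refine ⟨c, ?_⟩
  filter_upwards [Metric.ball_mem_nhds (0 : ℝ) (inv_pos.2 hR)] with x hx
  rcases eq_or_ne x 0 with rfl | hx0
  · rw [inversionMul_zero, abs_zero]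
    positivity
  have hxpos : 0 < |x| := abs_pos.2 hx0
  have hlt : |x| < R⁻¹ := by simpa using hx
  have hinv := hb x⁻¹ (by rw [abs_inv]; exact (lt_inv_comm₀ hxpos hR).1 hlt)
  rw [iteratedDeriv_zero, abs_inv, Nat.cast_zero, sub_zero, Real.inv_rpow hxpos.le,
    ← Real.rpow_neg hxpos.le] at hinv
  rw [inversionMul_of_ne_zero a h hx0, abs_mul, abs_zpow, sub_eq_add_neg,
    Real.rpow_add hxpos, Real.rpow_intCast]
  calc |x| ^ a * |h x⁻¹| ≤ |x| ^ a * (c * |x| ^ (-r)) := by gcongr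
    _ = c * (|x| ^ a * |x| ^ (-r)) := by ring

theorem OrderAtMost.continuousAt_inversionMul_zero {h : ℝ → ℝ} {r : ℝ} (hh : OrderAtMost h r)
    {a : ℤ} (ha : r < a) : ContinuousAt (inversionMul a h) 0 := by
  obtain ⟨c, hc⟩ := hh.eventually_abs_inversionMul_le a
  have hs : 0 < (a : ℝ) - r := sub_pos.2 ha
  have hcont : Continuous fun x : ℝ => c * |x| ^ ((a : ℝ) - r) :=
    continuous_const.mul (continuous_abs.rpow_const fun _ => Or.inr hs.le)
  have hlim := hcont.tendsto 0
  rw [abs_zero, Real.zero_rpow hs.ne', mul_zero] at hlim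
  rw [ContinuousAt, inversionMul_zero]
  exact squeeze_zero_norm' hc hlim

theorem hasDerivAt_inversionMul_of_ne_zero {h : ℝ → ℝ} (hh : Differentiable ℝ h) (a : ℤ) {x : ℝ}
    (hx : x ≠ 0) : HasDerivAt (inversionMul a h)
      (a * inversionMul (a - 1) h x - inversionMul (a - 2) (deriv h) x) x := by
  have hd := (hasDerivAt_zpow a x (Or.inl hx)).mul
    ((hh x⁻¹).hasDerivAt.comp x (hasDerivAt_inv hx))
  have heq : inversionMul a h =ᶠ[nhds x] fun y => y ^ a * h y⁻¹ := by
    filter_upwards [isOpen_ne.mem_nhds hx] with y hy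
    exact inversionMul_of_ne_zero a h hy
  refine (hd.congr_of_eventuallyEq heq).congr_deriv ?_
  rw [inversionMul_of_ne_zero _ _ hx, inversionMul_of_ne_zero _ _ hx, zpow_sub₀ hx a 2]
  simp only [Function.comp_apply, zpow_ofNat]
  ring

theorem OrderAtMost.hasDerivAt_inversionMul_zero {h : ℝ → ℝ} {r : ℝ} (hh : OrderAtMost h r)
    {a : ℤ} (ha : r + 1 < a) : HasDerivAt (inversionMul a h) 0 0 := by
  rw [hasDerivAt_iff_tendsto_slope]
  have hc : ContinuousAt (inversionMul (a - 1) h) 0 :=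
    hh.continuousAt_inversionMul_zero (by push_cast; linarith)
  rw [ContinuousAt, inversionMul_zero] at hc
  refine (hc.mono_left nhdsWithin_le_nhds).congr' ?_
  filter_upwards [self_mem_nhdsWithin] with x (hx : x ≠ 0)
  rw [slope_def_field, inversionMul_zero, inversionMul_of_ne_zero _ _ hx,
    inversionMul_of_ne_zero _ _ hx, zpow_sub_one₀ hx]
  ring

theorem OrderAtMost.contDiff_inversionMul (m : ℕ) {h : ℝ → ℝ} (hsm : ContDiff ℝ (⊤ : ℕ∞) h)
    {r : ℝ} (hh : OrderAtMost h r) {a : ℤ} (ha : r + m < a) : ContDiff ℝ m (inversionMul a h) := by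
  induction m generalizing h r a with
  | zero =>
    rw [Nat.cast_zero, contDiff_zero, continuous_iff_continuousAt]
    intro x
    rcases eq_or_ne x 0 with rfl | hx
    · exact hh.continuousAt_inversionMul_zero (by simpa using ha)
    · exact (hasDerivAt_inversionMul_of_ne_zero (hsm.differentiable (by simp)) a hx).continuousAt
  | succ m ih =>
    push_cast at ha
    have hm : (0 : ℝ) ≤ m := m.cast_nonneg
    have hd (x : ℝ) : HasDerivAt (inversionMul a h)
        (a * inversionMul (a - 1) h x - inversionMul (a - 2) (_root_.deriv h) x) x := by
      rcases eq_or_ne x 0 with rfl | hx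
      · simpa using hh.hasDerivAt_inversionMul_zero (a := a) (by linarith)
      · exact hasDerivAt_inversionMul_of_ne_zero (hsm.differentiable (by simp)) a hx
    rw [Nat.cast_succ, contDiff_succ_iff_deriv]
    refine ⟨fun x => (hd x).differentiableAt, by simp, ?_⟩
    rw [funext fun x => (hd x).deriv]
    exact (contDiff_const.mul (ih hsm hh (by push_cast; linarith))).sub
      (ih (contDiff_infty_iff_deriv.1 hsm).2 hh.deriv (by push_cast; linarith))

theorem gfun_eq_neg_inversionMul (f : ℝ → ℝ) (n : ℕ) :
    gfun f n = -inversionMul ((n - 2 : ℕ) : ℤ) (deriv f) := by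
  ext x
  rcases eq_or_ne x 0 with rfl | hx
  · simp [gfun]
  · simp [gfun, inversionMul, hx]

/-- if `f'` is of order at most `r` for some `r < −1` and `n ≥ 2`,
then `g_n` is of class `C^(n−1)` on all of `ℝ`. -/
theorem statement4 (f : ℝ → ℝ) (hf : ContDiff ℝ (⊤ : ℕ∞) f) (r : ℝ) (hr : r < -1)
    (hord : OrderAtMost (deriv f) r) (n : ℕ) (hn : 2 ≤ n) :
    ContDiff ℝ ((n - 1 : ℕ) : ℕ∞) (gfun f n) := by
  rw [gfun_eq_neg_inversionMul]
  refine (hord.contDiff_inversionMul (n - 1) (contDiff_infty_iff_deriv.1 hf).2 ?_).neg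
  obtain ⟨k, rfl⟩ := Nat.exists_eq_add_of_le' hn
  rw [show k + 2 - 1 = k + 1 by omega, Nat.add_sub_cancel]
  push_cast
  linarith
end

section
/- Let n ≥ 1, p ∈ ℝ_{≥0}, and let f ∈ C^∞(ℝ) be such that f' is of order at most −p−1. Then there exist R, c_2 > 0 such that for all real numbers x_1, …, x_n satisfying R < |x_1| ≤ ⋯ ≤ |x_n|, one has |f'{x_1, …, x_n}| ≤ c_2 |x_1|^{−p}. -/
open MeasureTheory

/-- Divided difference of order `n-1` of `f` at the `n` points `x`, defined via the
integral formula over the simplex (and set to `0` for the empty tuple). -/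
noncomputable def divDiff (f : ℝ → ℝ) : {n : ℕ} → (Fin n → ℝ) → ℝ
  | 0, _ => 0
  | m + 1, x =>
    ∫ t in {t : Fin m → ℝ | Monotone t ∧ ∀ j, t j ∈ Set.Icc (0 : ℝ) 1},
      iteratedDeriv m f (x (Fin.last m) + ∑ j : Fin m, (x j.castSucc - x j.succ) * t j)

/-- Weighted divided difference `f'{x_1,…,x_n} = (−1)^n x_1⋯x_n f'[x_1,…,x_n]`. -/
noncomputable def wDivDiff (f : ℝ → ℝ) {n : ℕ} (x : Fin n → ℝ) : ℝ :=
  (-1 : ℝ) ^ n * (∏ j, x j) * divDiff (deriv f) x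

/-- The region of integration in `divDiff`. -/
def orderedSimplex (m : ℕ) : Set (Fin m → ℝ) :=
  {t | Monotone t ∧ ∀ j, t j ∈ Set.Icc (0 : ℝ) 1}

/-- The argument of the integrand in `divDiff`: a convex combination of the `x j` when `t` lies in
the ordered simplex. -/
def simplexCombo {m : ℕ} (x : Fin (m + 1) → ℝ) (t : Fin m → ℝ) : ℝ :=
  x (Fin.last m) + ∑ j : Fin m, (x j.castSucc - x j.succ) * t j

theorem divDiff_eq_integral (g : ℝ → ℝ) {m : ℕ} (x : Fin (m + 1) → ℝ) :
    divDiff g x = ∫ t in orderedSimplex m, iteratedDeriv m g (simplexCombo x t) := rfl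

theorem isCompact_orderedSimplex (m : ℕ) : IsCompact (orderedSimplex m) := by
  have h : orderedSimplex m =
      Set.univ.pi (fun _ : Fin m => Set.Icc (0 : ℝ) 1) ∩ {t | Monotone t} := by
    ext t
    simp only [orderedSimplex, Set.mem_inter_iff, Set.mem_univ_pi, Set.mem_ofPred_eq]
    tauto
  rw [h]
  refine (isCompact_univ_pi fun _ => isCompact_Icc).inter_right ?_
  simp only [Monotone, Set.ofPred_forall]
  exact isClosed_iInter fun i => isClosed_iInter fun j => isClosed_iInter fun _ =>
    isClosed_le (continuous_apply i) (continuous_apply j)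

theorem continuous_simplexCombo {m : ℕ} (x : Fin (m + 1) → ℝ) :
    Continuous (simplexCombo x) := by
  unfold simplexCombo
  fun_prop

theorem insertNth_mem_orderedSimplex {m : ℕ} (j : Fin (m + 1)) (u : ℝ) (s : Fin m → ℝ) :
    (j.insertNth u s : Fin (m + 1) → ℝ) ∈ orderedSimplex (m + 1) ↔
      s ∈ orderedSimplex m ∧
        u ∈ Set.Icc ((Fin.cons 0 s : Fin (m + 1) → ℝ) j) ((Fin.snoc s 1 : Fin (m + 1) → ℝ) j) := by
  constructor
  · rintro ⟨hmono, hI⟩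
    have hs : ∀ i, s i = (j.insertNth u s : Fin (m + 1) → ℝ) (j.succAbove i) := fun i => by simp
    have hu : u = (j.insertNth u s : Fin (m + 1) → ℝ) j := by simp
    refine ⟨⟨fun a b hab => ?_, fun i => ?_⟩, ?_, ?_⟩
    · rw [hs a, hs b]
      exact hmono (Fin.strictMono_succAbove j |>.monotone hab)
    · rw [hs i]
      exact hI _
    · rcases Fin.eq_zero_or_eq_succ j with h | ⟨k, h⟩
      · have := (hI j).1
        rw [← hu] at this
        simpa [h] using this
      · have h1 : (Fin.cons 0 s : Fin (m + 1) → ℝ) j = s k := by simp [h]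
        rw [h1, hs k]
        conv_rhs => rw [hu]
        apply hmono
        rw [h, Fin.succAbove_of_castSucc_lt _ _ (Fin.castSucc_lt_succ)]
        exact Fin.castSucc_lt_succ.le
    · rcases Fin.eq_castSucc_or_eq_last j with ⟨k, h⟩ | h
      · have h1 : (Fin.snoc s 1 : Fin (m + 1) → ℝ) j = s k := by simp [h]
        rw [h1, hs k]
        conv_lhs => rw [hu]
        apply hmono
        rw [h, Fin.succAbove_of_le_castSucc _ _ le_rfl]
        exact Fin.castSucc_lt_succ.le
      · have := (hI j).2
        rw [← hu] at this
        simpa [h] using this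
  · rintro ⟨⟨hmono, hI⟩, hlo, hhi⟩
    have hlo' : ∀ i : Fin m, i.castSucc < j → s i ≤ u := by
      intro i hi
      obtain ⟨k, rfl⟩ := Fin.exists_succ_eq.2 (Fin.ne_zero_of_lt hi)
      rw [Fin.cons_succ] at hlo
      exact (hmono (by rw [Fin.lt_def] at hi; rw [Fin.le_def]; simp at hi; omega)).trans hlo
    have hhi' : ∀ i : Fin m, j ≤ i.castSucc → u ≤ s i := by
      intro i hi
      obtain ⟨k, rfl⟩ := Fin.exists_castSucc_eq.2 (hi.trans_lt (Fin.castSucc_lt_last i)).ne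
      rw [Fin.snoc_castSucc] at hhi
      exact hhi.trans (hmono (by simpa using hi))
    have hu0 : 0 ≤ u := by
      refine le_trans ?_ hlo
      cases j using Fin.cases with
      | zero => simp
      | succ k => simpa using (hI k).1
    have hu1 : u ≤ 1 := by
      refine hhi.trans ?_
      cases j using Fin.lastCases with
      | last => simp
      | cast k => simpa using (hI k).2
    refine ⟨fun a b hab => ?_, fun i => ?_⟩
    · rcases Fin.eq_self_or_eq_succAbove j a with ha | ⟨a, rfl⟩ <;>
        rcases Fin.eq_self_or_eq_succAbove j b with hb | ⟨b, rfl⟩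
      · rw [ha, hb]
      · subst ha
        simp only [Fin.insertNth_apply_same, Fin.insertNth_apply_succAbove]
        apply hhi'
        by_contra! h
        rw [Fin.succAbove_of_castSucc_lt _ _ h] at hab
        exact absurd hab h.not_ge
      · subst hb
        simp only [Fin.insertNth_apply_same, Fin.insertNth_apply_succAbove]
        apply hlo'
        by_contra! h
        rw [Fin.succAbove_of_le_castSucc _ _ h] at hab
        exact absurd (hab.trans h) (Fin.castSucc_lt_succ).not_ge
      · simp only [Fin.insertNth_apply_succAbove]
        exact hmono (Fin.strictMono_succAbove j |>.le_iff_le.1 hab)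
    · rcases Fin.eq_self_or_eq_succAbove j i with rfl | ⟨i, rfl⟩
      · simpa using ⟨hu0, hu1⟩
      · simpa using hI i

theorem cons_le_snoc_of_mem_orderedSimplex {m : ℕ} (j : Fin (m + 1)) {s : Fin m → ℝ}
    (hs : s ∈ orderedSimplex m) :
    (Fin.cons 0 s : Fin (m + 1) → ℝ) j ≤ (Fin.snoc s 1 : Fin (m + 1) → ℝ) j := by
  cases j using Fin.cases with
  | zero =>
    rcases Fin.eq_castSucc_or_eq_last (0 : Fin (m + 1)) with ⟨k, h⟩ | h
    · rw [h, Fin.snoc_castSucc, ← h, Fin.cons_zero]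
      exact (hs.2 k).1
    · rw [h, Fin.snoc_last, ← h, Fin.cons_zero]
      exact zero_le_one
  | succ k =>
    rw [Fin.cons_succ]
    rcases Fin.eq_castSucc_or_eq_last k.succ with ⟨l, h⟩ | h
    · rw [h, Fin.snoc_castSucc]
      refine hs.1 ?_
      rw [Fin.ext_iff] at h
      rw [Fin.le_def]
      simp at h
      omega
    · rw [h, Fin.snoc_last]
      exact (hs.2 k).2

theorem simplexCombo_insertNth_snoc {m : ℕ} (x : Fin (m + 2) → ℝ) (j : Fin (m + 1))
    (s : Fin m → ℝ) :
    simplexCombo x (j.insertNth ((Fin.snoc s 1 : Fin (m + 1) → ℝ) j) s) =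
      simplexCombo (fun i => x (j.succ.succAbove i)) s := by
  unfold simplexCombo
  rw [Fin.sum_univ_succAbove _ j]
  simp only [Fin.insertNth_apply_same, Fin.insertNth_apply_succAbove]
  cases j using Fin.lastCases with
  | last =>
    simp [Fin.succAbove_last]
    ring
  | cast k =>
    have key : ∀ i : Fin m, (x (k.castSucc.succ.succAbove i.castSucc) -
        x (k.castSucc.succ.succAbove i.succ)) * s i =
        (x (k.castSucc.succAbove i).castSucc - x (k.castSucc.succAbove i).succ) * s i +
        if i = k then (x k.castSucc.castSucc - x k.castSucc.succ) * s k else 0 := by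
      intro i
      rcases lt_trichotomy i k with h | rfl | h
      · have e1 : k.castSucc.succ.succAbove i.castSucc = i.castSucc.castSucc := by
          apply Fin.succAbove_of_castSucc_lt; simp only [Fin.lt_def, Fin.val_castSucc, Fin.val_succ] at h ⊢; omega
        have e2 : k.castSucc.succ.succAbove i.succ = i.succ.castSucc := by
          apply Fin.succAbove_of_castSucc_lt; simp only [Fin.lt_def, Fin.val_castSucc, Fin.val_succ] at h ⊢; omega
        have e3 : k.castSucc.succAbove i = i.castSucc := by
          apply Fin.succAbove_of_castSucc_lt; simpa using h
        rw [e1, e2, e3, if_neg h.ne, add_zero, Fin.succ_castSucc]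
      · have e1 : i.castSucc.succ.succAbove i.castSucc = i.castSucc.castSucc := by
          apply Fin.succAbove_of_castSucc_lt; simp
        have e2 : i.castSucc.succ.succAbove i.succ = i.succ.succ := by
          apply Fin.succAbove_of_le_castSucc; simp
        have e3 : i.castSucc.succAbove i = i.succ := by
          apply Fin.succAbove_of_le_castSucc; simp
        rw [e1, e2, e3, if_pos rfl, Fin.succ_castSucc]
        ring
      · have e1 : k.castSucc.succ.succAbove i.castSucc = i.castSucc.succ := by
          apply Fin.succAbove_of_le_castSucc; simp only [Fin.lt_def, Fin.le_def, Fin.val_castSucc, Fin.val_succ] at h ⊢; omega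
        have e2 : k.castSucc.succ.succAbove i.succ = i.succ.succ := by
          apply Fin.succAbove_of_le_castSucc; simp only [Fin.lt_def, Fin.le_def, Fin.val_castSucc, Fin.val_succ] at h ⊢; omega
        have e3 : k.castSucc.succAbove i = i.succ := by
          apply Fin.succAbove_of_le_castSucc; simpa using h.le
        rw [e1, e2, e3, if_neg h.ne', add_zero, Fin.succ_castSucc]
    have hl : k.castSucc.succ.succAbove (Fin.last m) = Fin.last (m + 1) := by
      apply Fin.succAbove_ne_last_last
      exact (by simp [Fin.ext_iff]; omega)
    simp only [key, Finset.sum_add_distrib, Finset.sum_ite_eq', Finset.mem_univ, if_true, hl,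
      Fin.snoc_castSucc]
    ring

theorem simplexCombo_insertNth_cons {m : ℕ} (x : Fin (m + 2) → ℝ) (j : Fin (m + 1))
    (s : Fin m → ℝ) :
    simplexCombo x (j.insertNth ((Fin.cons 0 s : Fin (m + 1) → ℝ) j) s) =
      simplexCombo (fun i => x (j.castSucc.succAbove i)) s := by
  unfold simplexCombo
  rw [Fin.sum_univ_succAbove _ j]
  simp only [Fin.insertNth_apply_same, Fin.insertNth_apply_succAbove]
  cases j using Fin.cases with
  | zero => simp
  | succ k =>
    have key : ∀ i : Fin m, (x (k.succ.castSucc.succAbove i.castSucc) -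
        x (k.succ.castSucc.succAbove i.succ)) * s i =
        (x (k.succ.succAbove i).castSucc - x (k.succ.succAbove i).succ) * s i +
        if i = k then (x k.succ.castSucc - x k.succ.succ) * s k else 0 := by
      intro i
      rcases lt_trichotomy i k with h | rfl | h
      · have e1 : k.succ.castSucc.succAbove i.castSucc = i.castSucc.castSucc := by
          apply Fin.succAbove_of_castSucc_lt; simp only [Fin.lt_def, Fin.val_castSucc, Fin.val_succ] at h ⊢; omega
        have e2 : k.succ.castSucc.succAbove i.succ = i.succ.castSucc := by
          apply Fin.succAbove_of_castSucc_lt; simp only [Fin.lt_def, Fin.val_castSucc, Fin.val_succ] at h ⊢; omega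
        have e3 : k.succ.succAbove i = i.castSucc := by
          apply Fin.succAbove_of_castSucc_lt; simp only [Fin.lt_def, Fin.val_castSucc, Fin.val_succ] at h ⊢; omega
        rw [e1, e2, e3, if_neg h.ne, add_zero, Fin.succ_castSucc]
      · have e1 : i.succ.castSucc.succAbove i.castSucc = i.castSucc.castSucc := by
          apply Fin.succAbove_of_castSucc_lt; simp
        have e2 : i.succ.castSucc.succAbove i.succ = i.succ.succ := by
          apply Fin.succAbove_of_le_castSucc; simp
        have e3 : i.succ.succAbove i = i.castSucc := by
          apply Fin.succAbove_of_castSucc_lt; simp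
        rw [e1, e2, e3, if_pos rfl, Fin.succ_castSucc]
        ring
      · have e1 : k.succ.castSucc.succAbove i.castSucc = i.castSucc.succ := by
          apply Fin.succAbove_of_le_castSucc; simp only [Fin.lt_def, Fin.le_def, Fin.val_castSucc, Fin.val_succ] at h ⊢; omega
        have e2 : k.succ.castSucc.succAbove i.succ = i.succ.succ := by
          apply Fin.succAbove_of_le_castSucc; simp only [Fin.lt_def, Fin.le_def, Fin.val_castSucc, Fin.val_succ] at h ⊢; omega
        have e3 : k.succ.succAbove i = i.succ := by
          apply Fin.succAbove_of_le_castSucc; simp only [Fin.lt_def, Fin.le_def, Fin.val_castSucc, Fin.val_succ] at h ⊢; omega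
        rw [e1, e2, e3, if_neg h.ne', add_zero, Fin.succ_castSucc]
    have hl : k.succ.castSucc.succAbove (Fin.last m) = Fin.last (m + 1) := by
      apply Fin.succAbove_ne_last_last
      exact (Fin.castSucc_lt_last _).ne
    simp only [key, Finset.sum_add_distrib, Finset.sum_ite_eq', Finset.mem_univ, if_true, hl,
      Fin.cons_succ]
    ring

theorem setIntegral_orderedSimplex_succ {m : ℕ} (j : Fin (m + 1)) {F : (Fin (m + 1) → ℝ) → ℝ}
    (hF : Continuous F) :
    ∫ t in orderedSimplex (m + 1), F t = ∫ s in orderedSimplex m,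
      ∫ u in ((Fin.cons 0 s : Fin (m + 1) → ℝ) j)..((Fin.snoc s 1 : Fin (m + 1) → ℝ) j),
        F (j.insertNth u s) := by
  have hmeas : ∀ k, MeasurableSet (orderedSimplex k) := fun k =>
    (isCompact_orderedSimplex k).measurableSet
  have hmp := (volume_preserving_piFinSuccAbove (fun _ : Fin (m + 1) => ℝ) j).symm
  have hint : Integrable ((orderedSimplex (m + 1)).indicator F) :=
    (hF.continuousOn.integrableOn_compact (isCompact_orderedSimplex _)).integrable_indicator
      (hmeas _)
  rw [← integral_indicator (hmeas _), ← integral_indicator (hmeas _),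
    ← hmp.integral_comp (MeasurableEquiv.measurableEmbedding _), Measure.volume_eq_prod,
    integral_prod_symm]
  · refine integral_congr_ae (.of_forall fun s => ?_)
    change ∫ u, (orderedSimplex (m + 1)).indicator F (j.insertNth u s) = _
    by_cases hs : s ∈ orderedSimplex m
    · rw [Set.indicator_of_mem hs,
        intervalIntegral.integral_of_le (cons_le_snoc_of_mem_orderedSimplex j hs),
        ← integral_Icc_eq_integral_Ioc, ← integral_indicator measurableSet_Icc]
      refine integral_congr_ae (.of_forall fun u => ?_)
      simp only [Set.indicator, insertNth_mem_orderedSimplex, hs, true_and]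
    · simp [Set.indicator, insertNth_mem_orderedSimplex, hs]
  · exact (hmp.integrable_comp_emb (MeasurableEquiv.measurableEmbedding _)).2 hint

theorem simplexCombo_insertNth {m : ℕ} (x : Fin (m + 2) → ℝ) (j : Fin (m + 1)) (u : ℝ)
    (s : Fin m → ℝ) :
    simplexCombo x (j.insertNth u s) =
      simplexCombo x (j.insertNth 0 s) + (x j.castSucc - x j.succ) * u := by
  unfold simplexCombo
  simp only [Fin.sum_univ_succAbove _ j, Fin.insertNth_apply_same, Fin.insertNth_apply_succAbove]
  ring

/-- The recursion for divided differences at two adjacent points. -/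
theorem sub_mul_divDiff {g : ℝ → ℝ} (hg : ContDiff ℝ (⊤ : ℕ∞) g) {m : ℕ}
    (x : Fin (m + 2) → ℝ) (j : Fin (m + 1)) :
    (x j.castSucc - x j.succ) * divDiff g x =
      divDiff g (fun i => x (j.succ.succAbove i)) -
        divDiff g (fun i => x (j.castSucc.succAbove i)) := by
  have hcont : ∀ k, Continuous (iteratedDeriv k g) := fun k =>
    hg.continuous_iteratedDeriv k (by exact_mod_cast le_top)
  have hint : ∀ y : Fin (m + 1) → ℝ,
      IntegrableOn (fun s => iteratedDeriv m g (simplexCombo y s)) (orderedSimplex m) := fun y =>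
    ((hcont m).comp (continuous_simplexCombo y)).continuousOn.integrableOn_compact
      (isCompact_orderedSimplex _)
  rw [divDiff_eq_integral, divDiff_eq_integral, divDiff_eq_integral,
    setIntegral_orderedSimplex_succ j
      (F := fun t => iteratedDeriv (m + 1) g (simplexCombo x t))
      ((hcont _).comp (continuous_simplexCombo x)),
    ← integral_sub (hint _) (hint _), ← integral_const_mul]
  refine integral_congr_ae (.of_forall fun s => ?_)
  simp only
  rw [← intervalIntegral.integral_const_mul, ← simplexCombo_insertNth_snoc,
    ← simplexCombo_insertNth_cons]
  have hd : ∀ u : ℝ, HasDerivAt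
      (fun u => iteratedDeriv m g (simplexCombo x (j.insertNth u s)))
      ((x j.castSucc - x j.succ) *
        iteratedDeriv (m + 1) g (simplexCombo x (j.insertNth u s))) u := by
    intro u
    have h1 : HasDerivAt (fun u => simplexCombo x (j.insertNth u s))
        (x j.castSucc - x j.succ) u := by
      rw [funext fun u => simplexCombo_insertNth x j u s]
      simpa using ((hasDerivAt_id u).const_mul (x j.castSucc - x j.succ)).const_add
        (simplexCombo x (j.insertNth 0 s))
    have h2 : HasDerivAt (iteratedDeriv m g)
        (iteratedDeriv (m + 1) g (simplexCombo x (j.insertNth u s)))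
        (simplexCombo x (j.insertNth u s)) := by
      rw [iteratedDeriv_succ]
      exact (hg.differentiable_iteratedDeriv m
        (by exact_mod_cast WithTop.coe_lt_top _)).differentiableAt.hasDerivAt
    rw [mul_comm]
    exact h2.comp u h1
  refine intervalIntegral.integral_eq_sub_of_hasDerivAt (fun u _ => hd u)
    (Continuous.intervalIntegrable ?_ _ _)
  refine continuous_const.mul ((hcont _).comp ?_)
  rw [funext fun u => simplexCombo_insertNth x j u s]
  fun_prop

theorem mul_le_mul_add_sum_sub_mul {m : ℕ} {x : Fin (m + 1) → ℝ} {t : Fin m → ℝ} {a T : ℝ}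
    (hx : ∀ j, a ≤ x j) (ht : Monotone t) (ht0 : ∀ j, 0 ≤ t j) (htT : ∀ j, t j ≤ T)
    (hT : 0 ≤ T) :
    T * a ≤ T * x (Fin.last m) + ∑ j : Fin m, (x j.castSucc - x j.succ) * t j := by
  induction m generalizing T with
  | zero => simpa using mul_le_mul_of_nonneg_left (hx 0) hT
  | succ m ih =>
    have h := ih (x := fun j => x j.castSucc) (t := fun j => t j.castSucc)
      (T := t (Fin.last m)) (fun j => hx _) (fun i j hij => ht (by simpa using hij))
      (fun j => ht0 _) (fun j => ht (Fin.le_last _)) (ht0 _)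
    have h2 := mul_le_mul_of_nonneg_left (hx (Fin.last (m + 1)))
      (sub_nonneg.2 (htT (Fin.last m)))
    rw [Fin.sum_univ_castSucc]
    simp only [Fin.succ_last, Fin.succ_castSucc] at h ⊢
    linarith

theorem le_simplexCombo {m : ℕ} {x : Fin (m + 1) → ℝ} {t : Fin m → ℝ} {a : ℝ}
    (hx : ∀ j, a ≤ x j) (ht : t ∈ orderedSimplex m) : a ≤ simplexCombo x t := by
  simpa [simplexCombo] using mul_le_mul_add_sum_sub_mul hx ht.1 (fun j => (ht.2 j).1)
    (fun j => (ht.2 j).2) zero_le_one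

theorem simplexCombo_neg {m : ℕ} (x : Fin (m + 1) → ℝ) (t : Fin m → ℝ) :
    simplexCombo (fun j => -x j) t = -simplexCombo x t := by
  simp only [simplexCombo, neg_add, ← Finset.sum_neg_distrib]
  congr 1
  exact Finset.sum_congr rfl fun j _ => by ring

/-- Nodes without large relative gaps all have the sign of the first one. -/
theorem abs_le_abs_simplexCombo {m : ℕ} {x : Fin (m + 1) → ℝ} {t : Fin m → ℝ}
    (hmono : Monotone fun j => |x j|)
    (hgap : ∀ j : Fin m, 2 * |x j.castSucc - x j.succ| < |x j.succ|)
    (ht : t ∈ orderedSimplex m) : |x 0| ≤ |simplexCombo x t| := by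
  wlog h0 : 0 ≤ x 0 generalizing x
  · have := this (x := fun j => -x j) (by simpa using hmono)
      (fun j => by
        have := hgap j
        rw [neg_sub_neg, abs_neg, abs_sub_comm]
        exact this)
      (by simpa using (not_le.1 h0).le)
    simpa [simplexCombo_neg] using this
  have hpos : ∀ j, 0 ≤ x j := by
    intro j
    induction j using Fin.induction with
    | zero => exact h0
    | succ i ih =>
      by_contra! hneg
      have := hgap i
      rw [abs_of_neg hneg, abs_of_nonneg (by linarith)] at this
      linarith
  refine (le_simplexCombo (fun j => ?_) ht).trans (le_abs_self _)
  exact (hmono (Fin.zero_le j)).trans_eq (abs_of_nonneg (hpos j))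

theorem abs_le_two_pow_mul {m : ℕ} {x : Fin (m + 1) → ℝ}
    (hgap : ∀ j : Fin m, 2 * |x j.castSucc - x j.succ| < |x j.succ|) (j : Fin (m + 1)) :
    |x j| ≤ 2 ^ (j : ℕ) * |x 0| := by
  induction j using Fin.induction with
  | zero => simp
  | succ i ih =>
    have h1 := hgap i
    have h2 : |x i.succ| - |x i.castSucc| ≤ |x i.castSucc - x i.succ| := by
      rw [abs_sub_comm]
      exact abs_sub_abs_le_abs_sub _ _
    rw [Fin.val_succ, pow_succ]
    rw [Fin.val_castSucc] at ih
    linarith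

theorem exists_bound_of_small_gaps {g : ℝ → ℝ} {p : ℝ} (hp : 0 ≤ p)
    (hord : OrderAtMost g (-p - 1)) (m : ℕ) :
    ∃ R c : ℝ, 0 < R ∧ 0 < c ∧ ∀ x : Fin (m + 1) → ℝ, R < |x 0| →
      (Monotone fun j => |x j|) →
      (∀ j : Fin m, 2 * |x j.castSucc - x j.succ| < |x j.succ|) →
        (∏ j, |x j|) * |divDiff g x| ≤ c * |x 0| ^ (-p) := by
  obtain ⟨R, C, hR, hC, hb⟩ := hord m
  set V := (volume (orderedSimplex m)).toReal
  have hV : 0 ≤ V := ENNReal.toReal_nonneg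
  refine ⟨R, (2 ^ m) ^ (m + 1) * (C * V) + 1, hR, by positivity, fun x hx hmono hgap => ?_⟩
  have ha : 0 < |x 0| := hR.trans hx
  have h1 : |divDiff g x| ≤ C * |x 0| ^ (-p - 1 - (m : ℝ)) * V := by
    rw [divDiff_eq_integral, ← Real.norm_eq_abs]
    refine norm_setIntegral_le_of_norm_le_const (μ := volume)
      (isCompact_orderedSimplex m).measure_lt_top fun t ht => ?_
    have hle := abs_le_abs_simplexCombo hmono hgap ht
    refine (hb _ (hx.trans_le hle)).trans ?_
    gcongr ?_ * ?_
    refine Real.rpow_le_rpow_of_nonpos ha hle ?_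
    have : (0 : ℝ) ≤ m := m.cast_nonneg
    linarith
  have h2 : ∏ j, |x j| ≤ (2 ^ m * |x 0|) ^ (m + 1) := by
    refine (Finset.prod_le_prod (fun j _ => abs_nonneg (x j)) fun j _ =>
      (abs_le_two_pow_mul hgap j).trans (?_ : _ ≤ 2 ^ m * |x 0|)).trans_eq (by simp)
    gcongr
    · norm_num
    · omega
  have h3 : |x 0| ^ (m + 1) * |x 0| ^ (-p - 1 - (m : ℝ)) = |x 0| ^ (-p) := by
    rw [← Real.rpow_natCast, ← Real.rpow_add ha]
    congr 1
    push_cast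
    ring
  calc (∏ j, |x j|) * |divDiff g x|
      ≤ (2 ^ m * |x 0|) ^ (m + 1) * (C * |x 0| ^ (-p - 1 - (m : ℝ)) * V) := by gcongr
    _ = (2 ^ m) ^ (m + 1) * (C * V) * (|x 0| ^ (m + 1) * |x 0| ^ (-p - 1 - (m : ℝ))) := by ring
    _ = (2 ^ m) ^ (m + 1) * (C * V) * |x 0| ^ (-p) := by rw [h3]
    _ ≤ _ := by
      gcongr
      linarith

theorem exists_bound_prod_mul_divDiff {g : ℝ → ℝ} (hg : ContDiff ℝ (⊤ : ℕ∞) g) {p : ℝ}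
    (hp : 0 ≤ p) (hord : OrderAtMost g (-p - 1)) (m : ℕ) :
    ∃ R c : ℝ, 0 < R ∧ 0 < c ∧ ∀ x : Fin (m + 1) → ℝ, R < |x 0| →
      (Monotone fun j => |x j|) → (∏ j, |x j|) * |divDiff g x| ≤ c * |x 0| ^ (-p) := by
  induction m with
  | zero =>
    obtain ⟨R, c, hR, hc, h⟩ := exists_bound_of_small_gaps hp hord 0
    exact ⟨R, c, hR, hc, fun x hx hm => h x hx hm fun j => j.elim0⟩
  | succ m ih =>
    obtain ⟨R₁, c₁, hR₁, hc₁, h₁⟩ := ih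
    obtain ⟨R₂, c₂, hR₂, hc₂, h₂⟩ := exists_bound_of_small_gaps hp hord (m + 1)
    refine ⟨max R₁ R₂, max (4 * c₁) c₂, by positivity, by positivity, fun x hx hmono => ?_⟩
    have ha : 0 < |x 0| := (hR₁.trans_le (le_max_left _ _)).trans hx
    by_cases hgap : ∀ j : Fin (m + 1), 2 * |x j.castSucc - x j.succ| < |x j.succ|
    · refine (h₂ x ((le_max_right _ _).trans_lt hx) hmono hgap).trans ?_
      gcongr
      exact le_max_right _ _
    push Not at hgap
    obtain ⟨j, hj⟩ := hgap
    have hbound : ∀ k : Fin (m + 2), (∏ i, |x (k.succAbove i)|) *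
        |divDiff g fun i => x (k.succAbove i)| ≤ c₁ * |x 0| ^ (-p) := by
      intro k
      have h0 : |x 0| ≤ |x (k.succAbove 0)| := hmono (Fin.zero_le _)
      refine (h₁ (fun i => x (k.succAbove i))
        (((le_max_left _ _).trans_lt hx).trans_le h0)
        (hmono.comp (Fin.strictMono_succAbove k).monotone)).trans ?_
      gcongr c₁ * ?_
      exact Real.rpow_le_rpow_of_nonpos ha h0 (by linarith)
    have hP : ∏ i, |x (j.succ.succAbove i)| ≤ ∏ i, |x (j.castSucc.succAbove i)| := by
      refine Finset.prod_le_prod (fun i _ => abs_nonneg _) fun i _ => hmono ?_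
      simp only [Fin.succAbove, Fin.le_def, Fin.lt_def]
      split_ifs <;> simp only [Fin.val_castSucc, Fin.val_succ] at * <;> omega
    set P := ∏ i, |x (j.succ.succAbove i)|
    have hP0 : 0 ≤ P := Finset.prod_nonneg fun i _ => abs_nonneg _
    set D := |divDiff g x|
    set A := |divDiff g fun i => x (j.succ.succAbove i)|
    set B := |divDiff g fun i => x (j.castSucc.succAbove i)|
    have hrec : |x j.castSucc - x j.succ| * D ≤ A + B := by
      rw [← abs_mul, sub_mul_divDiff hg]
      exact abs_sub _ _
    calc (∏ i, |x i|) * D = P * (|x j.succ| * D) := by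
          rw [Fin.prod_univ_succAbove _ j.succ]
          ring
      _ ≤ P * (2 * |x j.castSucc - x j.succ| * D) := by gcongr
      _ = 2 * (P * (|x j.castSucc - x j.succ| * D)) := by ring
      _ ≤ 2 * (P * (A + B)) := by gcongr
      _ = 2 * (P * A + P * B) := by ring
      _ ≤ 2 * (P * A + (∏ i, |x (j.castSucc.succAbove i)|) * B) := by gcongr
      _ ≤ 2 * (c₁ * |x 0| ^ (-p) + c₁ * |x 0| ^ (-p)) := by
          gcongr 2 * (?_ + ?_)
          · exact hbound _
          · exact hbound _
      _ = 4 * c₁ * |x 0| ^ (-p) := by ring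
      _ ≤ _ := by
          gcongr
          exact le_max_left _ _

/-- for `n ≥ 1`, `p ≥ 0` and `f'` of order at most `−p−1`, there are
`R, c₂ > 0` such that for all `R < |x_1| ≤ ⋯ ≤ |x_n|` one has
`|f'{x_1,…,x_n}| ≤ c₂ |x_1|^(−p)`. -/
theorem statement8 (n : ℕ) (hn : 1 ≤ n) (p : ℝ) (hp : 0 ≤ p)
    (f : ℝ → ℝ) (hf : ContDiff ℝ (⊤ : ℕ∞) f)
    (hord : OrderAtMost (deriv f) (-p - 1)) :
    ∃ R c₂ : ℝ, 0 < R ∧ 0 < c₂ ∧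
      ∀ x : Fin n → ℝ, R < |x ⟨0, hn⟩| → (Monotone fun j => |x j|) →
        |wDivDiff f x| ≤ c₂ * |x ⟨0, hn⟩| ^ (-p) := by
  obtain ⟨m, rfl⟩ : ∃ m, n = m + 1 := ⟨n - 1, by omega⟩
  have hg : ContDiff ℝ (⊤ : ℕ∞) (deriv f) := (contDiff_infty_iff_deriv.1 hf).2
  obtain ⟨R, c, hR, hc, h⟩ := exists_bound_prod_mul_divDiff hg hp hord m
  refine ⟨R, c, hR, hc, fun x hx hmono => ?_⟩
  rw [wDivDiff, abs_mul, abs_mul, abs_pow, abs_neg, abs_one, one_pow, one_mul, Finset.abs_prod]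
  exact h x hx hmono
end
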